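/- The differential of the pong algebra satisfies the Leibniz rule with respect to its product: for all a, b ∈ P(m, k), ∂(μ₂(a, b)) = μ₂(∂a, b) + μ₂(a, ∂b) (coefficients in F₂). -/

import Mathlib

open scoped Classical BigOperators

noncomputable section

/-- The group `G_m` of bijections of `ℤ` generated by the reflections
`x ↦ 1 - x` (about `1/2`) and `x ↦ 2m - 1 - x` (about `m - 1/2`). -/
def Gm (m : ℕ) : Subgroup (Equiv.Perm ℤ) :=
  Subgroup.closure {Equiv.subLeft (1 : ℤ), Equiv.subLeft (2 * (m : ℤ) - 1)}

/-- `y` lies in the `G_m`-orbit of `x`. -/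
def GmRel (m : ℕ) (x y : ℤ) : Prop := ∃ g ∈ Gm m, g x = y

/-- The `G_m`-orbit of an integer. -/
def GmOrbit (m : ℕ) (x : ℤ) : Set ℤ := {y | GmRel m x y}

/-- `(S, f)` is a lifted partial permutation on `k` letters: `S` is a
`G_m`-invariant subset of `ℤ`, `f` is `G_m`-equivariant on `S`, the quotient
`S/G_m` has exactly `k` elements, and the induced map `S/G_m → ℤ/G_m` is
injective.  (The values of `f` off `S` are irrelevant.) -/
structure IsLPP (m k : ℕ) (S : Set ℤ) (f : ℤ → ℤ) : Prop where
  invariant : ∀ g ∈ Gm m, ∀ x ∈ S, g x ∈ S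
  equivariant : ∀ g ∈ Gm m, ∀ x ∈ S, f (g x) = g (f x)
  orbits : (GmOrbit m '' S).ncard = k
  inj : ∀ x ∈ S, ∀ y ∈ S, GmRel m (f x) (f y) → GmRel m x y

/-- `(i, j)` is a crossing pair for `(S, f)`. -/
def IsCrossing (S : Set ℤ) (f : ℤ → ℤ) (i j : ℤ) : Prop :=
  i ∈ S ∧ j ∈ S ∧ i < j ∧ f j < f i

/-- The `G_m`-orbit of the unordered pair `{p.1, p.2}`; two pairs are
equivalent exactly when they have the same `pairOrbit`. -/
def pairOrbit (m : ℕ) (p : ℤ × ℤ) : Set (Set ℤ) :=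
  {A | ∃ g ∈ Gm m, A = {g p.1, g p.2}}

/-- The set of crossings of `(S, f)` (equivalence classes of crossing pairs). -/
def crossings (m : ℕ) (S : Set ℤ) (f : ℤ → ℤ) : Set (Set (Set ℤ)) :=
  pairOrbit m '' {p : ℤ × ℤ | IsCrossing S f p.1 p.2}

/-- The number of crossings `cross(f)`. -/
def crossCount (m : ℕ) (S : Set ℤ) (f : ℤ → ℤ) : ℕ := (crossings m S f).ncard

/-- The set whose cardinality (halved) is the weight `w_j(S, f)`. -/
def weightSet (j : ℤ) (S : Set ℤ) (f : ℤ → ℤ) : Set ℤ :=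
  {i | i ∈ S ∧ (((i : ℚ) < (j : ℚ) - 1/2 ∧ (j : ℚ) - 1/2 < (f i : ℚ)) ∨
    ((f i : ℚ) < (j : ℚ) - 1/2 ∧ (j : ℚ) - 1/2 < (i : ℚ)))}

/-- The weight `w_j(S, f)`. -/
def weight (j : ℤ) (S : Set ℤ) (f : ℤ → ℤ) : ℚ := (weightSet j S f).ncard / 2

/-- The resolution `f_{⟨i,j⟩}` of `f` at the crossing `⟨i, j⟩`. -/
def resolveFun (m : ℕ) (f : ℤ → ℤ) (i j : ℤ) : ℤ → ℤ := fun x =>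
  if h : ∃ g ∈ Gm m, g i = x then h.choose (f j)
  else if h' : ∃ g ∈ Gm m, g j = x then h'.choose (f i)
  else f x

/-- The graph `Γ_f = {(i, f i) : i ∈ S}`. -/
def graphOf (S : Set ℤ) (f : ℤ → ℤ) : Set (ℤ × ℤ) :=
  {p | p.1 ∈ S ∧ p.2 = f p.1}

/-- The `G_m`-orbit of a point of `ℤ × ℤ` under the diagonal action. -/
def GmOrbit2 (m : ℕ) (p : ℤ × ℤ) : Set (ℤ × ℤ) :=
  {q | ∃ g ∈ Gm m, (g p.1, g p.2) = q}

/-- The left endpoint of the image of the unit interval `[a, a+1]` under the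
affine extension of `g` to `ℝ`. -/
def sqIdx (g : Equiv.Perm ℤ) (a : ℤ) : ℤ := min (g a) (g (a + 1))

/-- The `G_m`-orbit of it the unit square indexed by `p`. -/
def sqOrbit (m : ℕ) (p : ℤ × ℤ) : Set (ℤ × ℤ) :=
  {q | ∃ g ∈ Gm m, (sqIdx g p.1, sqIdx g p.2) = q}

/-- `D` is a domain from `(S, f)` to `(T, g)`: a `G_m`-invariant assignment of
multiplicities to unit squares, nonzero on finitely many `G_m`-orbits of
squares, whose corners are governed by the two graphs. -/
def IsHDomain (m : ℕ) (S : Set ℤ) (f : ℤ → ℤ) (T : Set ℤ) (g : ℤ → ℤ)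
    (D : ℤ × ℤ → ℤ) : Prop :=
  (∀ γ ∈ Gm m, ∀ a b : ℤ, D (sqIdx γ a, sqIdx γ b) = D (a, b)) ∧
  (sqOrbit m '' {p : ℤ × ℤ | D p ≠ 0}).Finite ∧
  (∀ i j : ℤ,
    D (i, j) + D (i - 1, j - 1) - D (i, j - 1) - D (i - 1, j) =
      (if (i, j) ∈ graphOf T g then 1 else 0) -
        (if (i, j) ∈ graphOf S f then 1 else 0))

/-- The basis of the pong algebra: lifted partial permutations, normalized to
be the identity off their domain (so that each lifted partial permutation is
represented by exactly one basis element). -/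
def PongIdx (m k : ℕ) : Type :=
  {P : Set ℤ × (ℤ → ℤ) // IsLPP m k P.1 P.2 ∧ ∀ x ∉ P.1, P.2 x = x}

/-- The ground ring `F₂[v₁, …, v_m]` of the pong algebra. -/
abbrev PongRing (m : ℕ) := MvPolynomial (Fin m) (ZMod 2)

/-- The exponent vector `(w_l(f) - w_l(f'))_{l=1}^m` appearing in the
differential of the pong algebra. -/
def expDiff (m : ℕ) (S : Set ℤ) (f f' : ℤ → ℤ) : Fin m →₀ ℕ :=
  Finsupp.equivFunOnFinite.symm fun l =>
    ((weightSet (((l : ℕ) : ℤ) + 1) S f).ncard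
      - (weightSet (((l : ℕ) : ℤ) + 1) S f').ncard) / 2

/-- The exponent vector `(w_l(f) + w_l(g) - w_l(g ∘ f))_{l=1}^m` appearing in
the product of the pong algebra. -/
def expMul (m : ℕ) (S T : Set ℤ) (f g : ℤ → ℤ) : Fin m →₀ ℕ :=
  Finsupp.equivFunOnFinite.symm fun l =>
    ((weightSet (((l : ℕ) : ℤ) + 1) S f).ncard
      + (weightSet (((l : ℕ) : ℤ) + 1) T g).ncard
      - (weightSet (((l : ℕ) : ℤ) + 1) S (g ∘ f)).ncard) / 2

/-- The set of crossings of `(S, f)` whose resolution drops the crossing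
number by exactly one and yields the function `f'` (on `S`). -/
def resCrossSet (m : ℕ) (S : Set ℤ) (f f' : ℤ → ℤ) : Set (Set (Set ℤ)) :=
  pairOrbit m '' {p : ℤ × ℤ | IsCrossing S f p.1 p.2 ∧
    Set.EqOn (resolveFun m f p.1 p.2) f' S ∧
    crossCount m S (resolveFun m f p.1 p.2) + 1 = crossCount m S f}

/-- The structure constants of the differential `∂` of the pong algebra:
`∂ (S, f) = Σ_q Mdiff((S,f), q) · q`. -/
def Mdiff (m k : ℕ) (p q : PongIdx m k) : PongRing m :=
  if q.1.1 = p.1.1 then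
    MvPolynomial.monomial (expDiff m p.1.1 p.1.2 q.1.2)
      ((resCrossSet m p.1.1 p.1.2 q.1.2).ncard : ZMod 2)
  else 0

/-- The structure constants of the product `μ₂` of the pong algebra:
`μ₂(p, q) = Σ_s Mmul(p, q, s) · s`. -/
def Mmul (m k : ℕ) (p q s : PongIdx m k) : PongRing m :=
  if q.1.1 = p.1.2 '' p.1.1 ∧
      crossCount m p.1.1 (q.1.2 ∘ p.1.2)
        = crossCount m p.1.1 p.1.2 + crossCount m q.1.1 q.1.2 ∧
      s.1.1 = p.1.1 ∧ Set.EqOn s.1.2 (q.1.2 ∘ p.1.2) p.1.1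
  then MvPolynomial.monomial (expMul m p.1.1 q.1.1 p.1.2 q.1.2) 1
  else 0


/-! ### The group `G_m` -/

theorem Gm_cases {m : ℕ} {g : Equiv.Perm ℤ} (hg : g ∈ Gm m) :
    (∃ n : ℤ, ∀ x, g x = x + 2 * (n * ((m : ℤ) - 1))) ∨
      (∃ n : ℤ, ∀ x, g x = 1 - x + 2 * (n * ((m : ℤ) - 1))) := by
  induction hg using Subgroup.closure_induction with
  | mem g hg =>
    rcases hg with rfl | hg
    · exact Or.inr ⟨0, fun x => by simp⟩
    · rw [Set.mem_singleton_iff] at hg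
      subst hg
      exact Or.inr ⟨1, fun x => by simp; ring⟩
  | one => exact Or.inl ⟨0, fun x => by simp⟩
  | mul g h _ _ hg hh =>
    rcases hg with ⟨a, ha⟩ | ⟨a, ha⟩ <;> rcases hh with ⟨b, hb⟩ | ⟨b, hb⟩
    · exact Or.inl ⟨a + b, fun x => by rw [Equiv.Perm.mul_apply, ha, hb]; ring⟩
    · exact Or.inr ⟨a + b, fun x => by rw [Equiv.Perm.mul_apply, ha, hb]; ring⟩
    · exact Or.inr ⟨a - b, fun x => by rw [Equiv.Perm.mul_apply, ha, hb]; ring⟩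
    · exact Or.inl ⟨a - b, fun x => by rw [Equiv.Perm.mul_apply, ha, hb]; ring⟩
  | inv g _ hg =>
    rcases hg with ⟨a, ha⟩ | ⟨a, ha⟩
    · exact Or.inl ⟨-a, fun x => by rw [Equiv.Perm.inv_eq_iff_eq, ha]; ring⟩
    · exact Or.inr ⟨a, fun x => by rw [Equiv.Perm.inv_eq_iff_eq, ha]; ring⟩

theorem Gm_eq_of_apply_eq {m : ℕ} {g h : Equiv.Perm ℤ} (hg : g ∈ Gm m) (hh : h ∈ Gm m)
    {x : ℤ} (e : g x = h x) : g = h := by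
  ext y
  rcases Gm_cases hg with ⟨a, ha⟩ | ⟨a, ha⟩ <;> rcases Gm_cases hh with ⟨b, hb⟩ | ⟨b, hb⟩ <;>
    rw [ha, hb] at e <;> rw [ha, hb] <;>
    generalize a * ((m : ℤ) - 1) = u at * <;> generalize b * ((m : ℤ) - 1) = v at * <;> omega

/-- An element of `G_m` acts by an order-preserving or order-reversing isometry. -/
theorem Gm_sub {m : ℕ} {g : Equiv.Perm ℤ} (hg : g ∈ Gm m) :
    (∀ x y, g x - g y = x - y) ∨ (∀ x y, g x - g y = y - x) := by
  rcases Gm_cases hg with ⟨a, ha⟩ | ⟨a, ha⟩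
  · exact Or.inl fun x y => by rw [ha, ha]; ring
  · exact Or.inr fun x y => by rw [ha, ha]; ring

theorem Gm_translation_mem (m : ℕ) (n : ℤ) :
    Equiv.addRight (2 * (n * ((m : ℤ) - 1))) ∈ Gm m := by
  have h : Equiv.subLeft (2 * (m : ℤ) - 1) * Equiv.subLeft (1 : ℤ) ∈ Gm m :=
    mul_mem (Subgroup.subset_closure (by simp)) (Subgroup.subset_closure (by simp))
  have e : Equiv.subLeft (2 * (m : ℤ) - 1) * Equiv.subLeft (1 : ℤ) =
      Equiv.addRight (2 * ((m : ℤ) - 1)) := by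
    ext x
    simp
    ring
  rw [e] at h
  have := (Gm m).zpow_mem h n
  convert this using 1
  ext x
  simp
  ring

/-- An element of `G_m` is a translation or an involution. -/
theorem Gm_translation_or_involutive {m : ℕ} {g : Equiv.Perm ℤ} (hg : g ∈ Gm m) :
    (∃ n : ℤ, ∀ x, g x = x + 2 * (n * ((m : ℤ) - 1))) ∨ (∀ x, g (g x) = x) := by
  rcases Gm_cases hg with h | ⟨a, ha⟩
  · exact Or.inl h
  · exact Or.inr fun x => by rw [ha, ha]; ring

/-! ### Orbits of pairs -/

theorem pairOrbit_eq_iff {m : ℕ} {a b c d : ℤ} :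
    pairOrbit m (a, b) = pairOrbit m (c, d) ↔
      ∃ g ∈ Gm m, (g a = c ∧ g b = d) ∨ (g a = d ∧ g b = c) := by
  constructor
  · intro h
    have : ({c, d} : Set ℤ) ∈ pairOrbit m (a, b) := h ▸ ⟨1, one_mem _, by simp⟩
    obtain ⟨g, hg, e⟩ := this
    refine ⟨g, hg, ?_⟩
    rcases Set.pair_eq_pair_iff.1 e with ⟨h1, h2⟩ | ⟨h1, h2⟩
    · exact Or.inl ⟨h1.symm, h2.symm⟩
    · exact Or.inr ⟨h2.symm, h1.symm⟩
  · rintro ⟨g, hg, h⟩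
    have e : ({c, d} : Set ℤ) = {g a, g b} := by
      rcases h with ⟨rfl, rfl⟩ | ⟨rfl, rfl⟩
      · rfl
      · exact Set.pair_comm _ _
    ext A
    constructor
    · rintro ⟨k, hk, rfl⟩
      refine ⟨k * g⁻¹, mul_mem hk (inv_mem hg), ?_⟩
      have := congrArg (fun s => (k * g⁻¹) '' s) e
      simpa [Set.image_pair] using this.symm
    · rintro ⟨k, hk, rfl⟩
      refine ⟨k * g, mul_mem hk hg, ?_⟩
      have := congrArg (fun s => k '' s) e
      simpa [Set.image_pair] using this

theorem pairOrbit_comm (m : ℕ) (a b : ℤ) : pairOrbit m (a, b) = pairOrbit m (b, a) :=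
  pairOrbit_eq_iff.2 ⟨1, one_mem _, Or.inr ⟨rfl, rfl⟩⟩

/-! ### Lifted partial permutations -/

namespace IsLPP

variable {m k : ℕ} {S : Set ℤ} {f g : ℤ → ℤ}

theorem injOn (h : IsLPP m k S f) : Set.InjOn f S := by
  intro x hx y hy e
  obtain ⟨g, hg, rfl⟩ := h.inj x hx y hy ⟨1, one_mem _, by simpa using e⟩
  rw [h.equivariant g hg x hx] at e
  have : (1 : Equiv.Perm ℤ) = g := Gm_eq_of_apply_eq (one_mem _) hg (by simpa using e)
  simp [← this]

theorem congr (h : IsLPP m k S f) (e : Set.EqOn g f S) : IsLPP m k S g where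
  invariant := h.invariant
  equivariant γ hγ x hx := by rw [e (h.invariant γ hγ x hx), e hx, h.equivariant γ hγ x hx]
  orbits := h.orbits
  inj x hx y hy r := h.inj x hx y hy (by rwa [e hx, e hy] at r)

theorem comp (hf : IsLPP m k S f) (hg : IsLPP m k (f '' S) g) : IsLPP m k S (g ∘ f) where
  invariant := hf.invariant
  equivariant γ hγ x hx := by
    simp only [Function.comp]
    rw [hf.equivariant γ hγ x hx, hg.equivariant γ hγ _ ⟨x, hx, rfl⟩]
  orbits := hf.orbits
  inj x hx y hy r := hf.inj x hx y hy (hg.inj _ ⟨x, hx, rfl⟩ _ ⟨y, hy, rfl⟩ r)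

theorem pairOrbit_map (hf : IsLPP m k S f) {a b : ℤ} (ha : a ∈ S) (hb : b ∈ S) :
    pairOrbit m (f a, f b) = Set.image (Set.image f) (pairOrbit m (a, b)) := by
  ext A
  constructor
  · rintro ⟨γ, hγ, rfl⟩
    refine ⟨{γ a, γ b}, ⟨γ, hγ, rfl⟩, ?_⟩
    rw [Set.image_pair, hf.equivariant γ hγ a ha, hf.equivariant γ hγ b hb]
  · rintro ⟨_, ⟨γ, hγ, rfl⟩, rfl⟩
    refine ⟨γ, hγ, ?_⟩
    rw [Set.image_pair, hf.equivariant γ hγ a ha, hf.equivariant γ hγ b hb]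

theorem pairOrbit_map_inj (hf : IsLPP m k S f) {a b c d : ℤ} (ha : a ∈ S) (hb : b ∈ S)
    (hc : c ∈ S) (hd : d ∈ S) (e : pairOrbit m (f a, f b) = pairOrbit m (f c, f d)) :
    pairOrbit m (a, b) = pairOrbit m (c, d) := by
  obtain ⟨γ, hγ, h⟩ := pairOrbit_eq_iff.1 e
  rw [← hf.equivariant γ hγ a ha, ← hf.equivariant γ hγ b hb] at h
  have ha' := hf.invariant γ hγ a ha
  have hb' := hf.invariant γ hγ b hb
  refine pairOrbit_eq_iff.2 ⟨γ, hγ, h.imp ?_ ?_⟩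
  · exact fun h => ⟨hf.injOn ha' hc h.1, hf.injOn hb' hd h.2⟩
  · exact fun h => ⟨hf.injOn ha' hd h.1, hf.injOn hb' hc h.2⟩

theorem exists_bound (hf : IsLPP m k S f) (hm : 2 ≤ m) : ∃ B : ℤ, ∀ x ∈ S, |f x - x| ≤ B := by
  have hfin : (Set.Icc (0 : ℤ) (2 * (m : ℤ))).Finite := Set.finite_Icc _ _
  obtain ⟨B, hB⟩ := (hfin.image fun x => |f x - x|).bddAbove
  refine ⟨B, fun x hx => ?_⟩
  set P : ℤ := 2 * ((m : ℤ) - 1) with hP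
  have hPpos : 0 < P := by omega
  have hγ := Gm_translation_mem m (-(x / P))
  have ex : (Equiv.addRight (2 * (-(x / P) * ((m : ℤ) - 1)))) x = x % P := by
    have := Int.emod_add_mul_ediv x P
    simp only [Equiv.coe_addRight]
    linear_combination -this + (x / P) * hP
  have e := hf.equivariant _ hγ x hx
  have : f (x % P) - x % P = f x - x := by
    rw [← ex, e]
    simp
  rw [← this]
  exact hB ⟨x % P, ⟨Int.emod_nonneg _ hPpos.ne', by
    have := Int.emod_lt_of_pos x hPpos
    omega⟩, rfl⟩

end IsLPP

/-- The pair `i`, `j` is crossed by `f`, irrespective of the order of `i` and `j`. -/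
def Crosses (f : ℤ → ℤ) (i j : ℤ) : Prop := (i < j ∧ f j < f i) ∨ (j < i ∧ f i < f j)

theorem Crosses.symm {f : ℤ → ℤ} {i j : ℤ} (h : Crosses f i j) : Crosses f j i := Or.symm h

theorem mem_crossings {m : ℕ} {S : Set ℤ} {f : ℤ → ℤ} {c : Set (Set ℤ)} :
    c ∈ crossings m S f ↔ ∃ i ∈ S, ∃ j ∈ S, Crosses f i j ∧ pairOrbit m (i, j) = c := by
  constructor
  · rintro ⟨⟨i, j⟩, ⟨hi, hj, h⟩, rfl⟩
    exact ⟨i, hi, j, hj, Or.inl h, rfl⟩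
  · rintro ⟨i, hi, j, hj, h | h, rfl⟩
    · exact ⟨(i, j), ⟨hi, hj, h⟩, rfl⟩
    · exact ⟨(j, i), ⟨hj, hi, h⟩, pairOrbit_comm _ _ _⟩

theorem crossings_congr {m : ℕ} {S : Set ℤ} {f g : ℤ → ℤ} (e : Set.EqOn f g S) :
    crossings m S f = crossings m S g := by
  ext c
  simp only [mem_crossings, Crosses]
  constructor
  · rintro ⟨i, hi, j, hj, h, rfl⟩
    exact ⟨i, hi, j, hj, by rwa [e hi, e hj] at h, rfl⟩
  · rintro ⟨i, hi, j, hj, h, rfl⟩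
    exact ⟨i, hi, j, hj, by rwa [e hi, e hj], rfl⟩

theorem crossCount_congr {m : ℕ} {S : Set ℤ} {f g : ℤ → ℤ} (e : Set.EqOn f g S) :
    crossCount m S f = crossCount m S g := by
  rw [crossCount, crossCount, crossings_congr e]

namespace IsLPP

variable {m k : ℕ} {S : Set ℤ} {f g : ℤ → ℤ}

theorem crosses_smul_iff (hf : IsLPP m k S f) {γ : Equiv.Perm ℤ} (hγ : γ ∈ Gm m) {i j : ℤ}
    (hi : i ∈ S) (hj : j ∈ S) : Crosses f (γ i) (γ j) ↔ Crosses f i j := by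
  unfold Crosses
  rw [hf.equivariant γ hγ i hi, hf.equivariant γ hγ j hj]
  rcases Gm_sub hγ with h | h <;>
  · have h1 := h i j
    have h2 := h (f i) (f j)
    omega

theorem pairOrbit_mem_crossings_iff (hf : IsLPP m k S f) {i j : ℤ} (hi : i ∈ S) (hj : j ∈ S) :
    pairOrbit m (i, j) ∈ crossings m S f ↔ Crosses f i j := by
  rw [mem_crossings]
  constructor
  · rintro ⟨a, ha, b, hb, h, e⟩
    obtain ⟨γ, hγ, ⟨rfl, rfl⟩ | ⟨rfl, rfl⟩⟩ := pairOrbit_eq_iff.1 e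
    · exact (hf.crosses_smul_iff hγ ha hb).2 h
    · exact ((hf.crosses_smul_iff hγ ha hb).2 h).symm
  · exact fun h => ⟨i, hi, j, hj, h, rfl⟩

theorem crossings_finite (hf : IsLPP m k S f) (hm : 2 ≤ m) : (crossings m S f).Finite := by
  obtain ⟨B, hB⟩ := hf.exists_bound hm
  refine (((Set.finite_Icc (0 : ℤ) (2 * (m : ℤ))).prod
    (Set.finite_Icc (-2 * B) (2 * (m : ℤ) + 2 * B))).image (pairOrbit m)).subset ?_
  rintro c ⟨⟨i, j⟩, ⟨hi, hj, h1, h2⟩, rfl⟩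
  simp only at hi hj h1 h2
  set P : ℤ := 2 * ((m : ℤ) - 1) with hP
  have hPpos : 0 < P := by omega
  have hγ := Gm_translation_mem m (-(i / P))
  have ei : (Equiv.addRight (2 * (-(i / P) * ((m : ℤ) - 1)))) i = i % P := by
    have := Int.emod_add_mul_ediv i P
    simp only [Equiv.coe_addRight]
    linear_combination -this + (i / P) * hP
  have ej : (Equiv.addRight (2 * (-(i / P) * ((m : ℤ) - 1)))) j = i % P + (j - i) := by
    rw [← ei]
    simp only [Equiv.coe_addRight]
    ring
  refine ⟨(i % P, i % P + (j - i)), ⟨?_, ?_⟩, ?_⟩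
  · have := Int.emod_lt_of_pos i hPpos
    exact ⟨Int.emod_nonneg _ hPpos.ne', by simp only; omega⟩
  · have := Int.emod_lt_of_pos i hPpos
    have := Int.emod_nonneg i hPpos.ne'
    have := abs_le.1 (hB i hi)
    have := abs_le.1 (hB j hj)
    simp only [Set.mem_Icc]
    omega
  · exact (pairOrbit_eq_iff.2 ⟨_, hγ, Or.inl ⟨ei, ej⟩⟩).symm

theorem ncard_crossings_comp_diff_le (hf : IsLPP m k S f) (hg : IsLPP m k (f '' S) g)
    (hm : 2 ≤ m) :
    (crossings m S (g ∘ f) \ crossings m S f).ncard ≤ crossCount m (f '' S) g := by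
  refine Set.ncard_le_ncard_of_injOn (Set.image (Set.image f)) ?_ ?_ (hg.crossings_finite hm)
  · rintro c ⟨hc, hc'⟩
    obtain ⟨i, hi, j, hj, h, rfl⟩ := mem_crossings.1 hc
    rw [hf.pairOrbit_mem_crossings_iff hi hj] at hc'
    rw [← hf.pairOrbit_map hi hj]
    refine mem_crossings.2 ⟨_, ⟨i, hi, rfl⟩, _, ⟨j, hj, rfl⟩, ?_, rfl⟩
    have hne : f i = f j → i = j := fun e => hf.injOn hi hj e
    simp only [Crosses, Function.comp] at h hc' ⊢
    omega
  · rintro c ⟨hc, -⟩ d ⟨hd, -⟩ e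
    obtain ⟨i, hi, j, hj, -, rfl⟩ := mem_crossings.1 hc
    obtain ⟨i', hi', j', hj', -, rfl⟩ := mem_crossings.1 hd
    rw [← hf.pairOrbit_map hi hj, ← hf.pairOrbit_map hi' hj'] at e
    exact hf.pairOrbit_map_inj hi hj hi' hj' e

theorem crossCount_comp_le (hf : IsLPP m k S f) (hg : IsLPP m k (f '' S) g) (hm : 2 ≤ m) :
    crossCount m S (g ∘ f) ≤ crossCount m S f + crossCount m (f '' S) g := by
  have h1 := hf.ncard_crossings_comp_diff_le hg hm
  have h2 := Set.ncard_le_ncard_sdiff_add_ncard (crossings m S (g ∘ f)) (crossings m S f)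
    (hf.crossings_finite hm)
  unfold crossCount at *
  omega

theorem crossCount_comp_lt (hf : IsLPP m k S f) (hg : IsLPP m k (f '' S) g) (hm : 2 ≤ m)
    {i j : ℤ} (hi : i ∈ S) (hj : j ∈ S) (h : Crosses f i j) (h' : Crosses g (f i) (f j)) :
    crossCount m S (g ∘ f) < crossCount m S f + crossCount m (f '' S) g := by
  have h1 := hf.ncard_crossings_comp_diff_le hg hm
  have hfin := hf.crossings_finite hm
  have h2 := Set.ncard_inter_add_ncard_sdiff_eq_ncard (crossings m S (g ∘ f)) (crossings m S f)
    ((hf.comp hg).crossings_finite hm)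
  have h3 : (crossings m S (g ∘ f) ∩ crossings m S f).ncard < (crossings m S f).ncard := by
    refine Set.ncard_lt_ncard ⟨Set.inter_subset_right, fun hsub => ?_⟩ hfin
    have := (hsub ((hf.pairOrbit_mem_crossings_iff hi hj).2 h)).1
    rw [(hf.comp hg).pairOrbit_mem_crossings_iff hi hj] at this
    simp only [Crosses, Function.comp] at this h h'
    omega
  unfold crossCount at *
  omega

end IsLPP

/-! ### Swapping two orbits -/

/-- The `G_m`-equivariant involution of `ℤ` that exchanges `i` and `j`. -/
def swapFun (m : ℕ) (i j : ℤ) : ℤ → ℤ := resolveFun m id i j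

/-- `i` and `j` do not differ by a translation in `G_m`. -/
def NonTranslate (m : ℕ) (i j : ℤ) : Prop := ∀ n : ℤ, j ≠ i + 2 * (n * ((m : ℤ) - 1))

theorem NonTranslate.ne {m : ℕ} {i j : ℤ} (h : NonTranslate m i j) : i ≠ j := by
  rintro rfl
  exact h 0 (by simp)

theorem NonTranslate.symm {m : ℕ} {i j : ℤ} (h : NonTranslate m i j) : NonTranslate m j i :=
  fun n e => h (-n) (by rw [e]; ring)

theorem swapFun_left {m : ℕ} {γ : Equiv.Perm ℤ} (hγ : γ ∈ Gm m) (i j : ℤ) :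
    swapFun m i j (γ i) = γ j := by
  have h : ∃ g ∈ Gm m, g i = γ i := ⟨γ, hγ, rfl⟩
  rw [swapFun, resolveFun, dif_pos h, Gm_eq_of_apply_eq h.choose_spec.1 hγ h.choose_spec.2]
  rfl

theorem swapFun_right {m : ℕ} {γ : Equiv.Perm ℤ} (hγ : γ ∈ Gm m) {i j : ℤ}
    (hij : NonTranslate m i j) : swapFun m i j (γ j) = γ i := by
  by_cases h : ∃ g ∈ Gm m, g i = γ j
  · obtain ⟨g, hg, e⟩ := h
    rw [← e, swapFun_left hg]
    have hδ : γ⁻¹ * g ∈ Gm m := mul_mem (inv_mem hγ) hg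
    have ej : (γ⁻¹ * g) i = j := by simp [e]
    rcases Gm_translation_or_involutive hδ with ⟨n, hn⟩ | hinv
    · exact absurd (ej ▸ hn i) (hij n)
    · have := hinv i
      rw [ej, Equiv.Perm.mul_apply, Equiv.Perm.inv_eq_iff_eq] at this
      exact this
  · have h' : ∃ g ∈ Gm m, g j = γ j := ⟨γ, hγ, rfl⟩
    rw [swapFun, resolveFun, dif_neg h, dif_pos h',
      Gm_eq_of_apply_eq h'.choose_spec.1 hγ h'.choose_spec.2]
    rfl

theorem swapFun_of_notMem {m : ℕ} {i j x : ℤ} (hi : ∀ γ ∈ Gm m, γ i ≠ x)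
    (hj : ∀ γ ∈ Gm m, γ j ≠ x) : swapFun m i j x = x := by
  rw [swapFun, resolveFun, dif_neg (by simpa using hi), dif_neg (by simpa using hj)]
  rfl

theorem swapFun_cases (m : ℕ) (i j x : ℤ) :
    (∃ γ ∈ Gm m, γ i = x) ∨ (∃ γ ∈ Gm m, γ j = x) ∨
      ((∀ γ ∈ Gm m, γ i ≠ x) ∧ (∀ γ ∈ Gm m, γ j ≠ x)) := by
  by_cases h : ∃ γ ∈ Gm m, γ i = x
  · exact Or.inl h
  by_cases h' : ∃ γ ∈ Gm m, γ j = x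
  · exact Or.inr (Or.inl h')
  · push Not at h h'
    exact Or.inr (Or.inr ⟨h, h'⟩)

theorem swapFun_smul {m : ℕ} {γ : Equiv.Perm ℤ} (hγ : γ ∈ Gm m) {i j : ℤ}
    (hij : NonTranslate m i j) (x : ℤ) : swapFun m i j (γ x) = γ (swapFun m i j x) := by
  rcases swapFun_cases m i j x with ⟨g, hg, rfl⟩ | ⟨g, hg, rfl⟩ | ⟨h, h'⟩
  · rw [← Equiv.Perm.mul_apply, swapFun_left (mul_mem hγ hg), swapFun_left hg]
    rfl
  · rw [← Equiv.Perm.mul_apply, swapFun_right (mul_mem hγ hg) hij, swapFun_right hg hij]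
    rfl
  · rw [swapFun_of_notMem h h', swapFun_of_notMem]
    · exact fun g hg e => h _ (mul_mem (inv_mem hγ) hg) (by simp [e])
    · exact fun g hg e => h' _ (mul_mem (inv_mem hγ) hg) (by simp [e])

theorem swapFun_swapFun {m : ℕ} {i j : ℤ} (hij : NonTranslate m i j) (x : ℤ) :
    swapFun m i j (swapFun m i j x) = x := by
  rcases swapFun_cases m i j x with ⟨g, hg, rfl⟩ | ⟨g, hg, rfl⟩ | ⟨h, h'⟩
  · rw [swapFun_left hg, swapFun_right hg hij]
  · rw [swapFun_right hg hij, swapFun_left hg]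
  · rw [swapFun_of_notMem h h', swapFun_of_notMem h h']

theorem swapFun_comm {m : ℕ} {i j : ℤ} (hij : NonTranslate m i j) :
    swapFun m i j = swapFun m j i := by
  ext x
  rcases swapFun_cases m i j x with ⟨g, hg, rfl⟩ | ⟨g, hg, rfl⟩ | ⟨h, h'⟩
  · rw [swapFun_left hg, swapFun_right hg hij.symm]
  · rw [swapFun_right hg hij, swapFun_left hg]
  · rw [swapFun_of_notMem h h', swapFun_of_notMem h' h]

theorem swapFun_sub_self {m : ℕ} {i j : ℤ} (hij : NonTranslate m i j) (x : ℤ) :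
    swapFun m i j x = x ∨ swapFun m i j x - x = j - i ∨ swapFun m i j x - x = i - j := by
  rcases swapFun_cases m i j x with ⟨g, hg, rfl⟩ | ⟨g, hg, rfl⟩ | ⟨h, h'⟩
  · rw [swapFun_left hg]
    exact Or.inr ((Gm_sub hg).imp (fun h => h _ _) (fun h => h _ _))
  · rw [swapFun_right hg hij]
    exact Or.inr ((Gm_sub hg).symm.imp (fun h => h _ _) (fun h => h _ _))
  · exact Or.inl (swapFun_of_notMem h h')

/-- The unordered pair `{i, j}` is determined up to `G_m` by the swap of `i` and `j`. -/
theorem pairOrbit_eq_of_swapFun {m : ℕ} {i j a b : ℤ} (hij : NonTranslate m i j)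
    (hab : a ≠ b) (h : swapFun m i j a = b) : pairOrbit m (i, j) = pairOrbit m (a, b) := by
  rcases swapFun_cases m i j a with ⟨g, hg, rfl⟩ | ⟨g, hg, rfl⟩ | ⟨h1, h2⟩
  · exact pairOrbit_eq_iff.2 ⟨g, hg, Or.inl ⟨rfl, by rw [← h, swapFun_left hg]⟩⟩
  · exact pairOrbit_eq_iff.2 ⟨g, hg, Or.inr ⟨by rw [← h, swapFun_right hg hij], rfl⟩⟩
  · exact absurd ((swapFun_of_notMem h1 h2).symm.trans h) hab

theorem swapFun_self_left (m : ℕ) (i j : ℤ) : swapFun m i j i = j :=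
  swapFun_left (one_mem (Gm m)) i j

theorem swapFun_self_right {m : ℕ} {i j : ℤ} (hij : NonTranslate m i j) :
    swapFun m i j j = i :=
  swapFun_right (one_mem (Gm m)) hij

theorem swapFun_crosses {m : ℕ} {i j : ℤ} (hij : NonTranslate m i j) :
    Crosses (swapFun m i j) i j := by
  rw [Crosses, swapFun_self_left, swapFun_self_right hij]
  have := hij.ne
  omega

namespace IsLPP

variable {m k : ℕ} {S : Set ℤ} {f g : ℤ → ℤ} {i j : ℤ}

theorem swapFun_mem (hf : IsLPP m k S f) (hi : i ∈ S) (hj : j ∈ S) (hij : NonTranslate m i j)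
    {x : ℤ} (hx : x ∈ S) : swapFun m i j x ∈ S := by
  rcases swapFun_cases m i j x with ⟨g, hg, rfl⟩ | ⟨g, hg, rfl⟩ | ⟨h, h'⟩
  · rw [swapFun_left hg]
    exact hf.invariant g hg j hj
  · rw [swapFun_right hg hij]
    exact hf.invariant g hg i hi
  · rwa [swapFun_of_notMem h h']

theorem swapFun_image (hf : IsLPP m k S f) (hi : i ∈ S) (hj : j ∈ S)
    (hij : NonTranslate m i j) : swapFun m i j '' S = S := by
  ext x
  constructor
  · rintro ⟨y, hy, rfl⟩
    exact hf.swapFun_mem hi hj hij hy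
  · exact fun hx => ⟨_, hf.swapFun_mem hi hj hij hx, swapFun_swapFun hij x⟩

theorem isLPP_swapFun (hf : IsLPP m k S f) (hij : NonTranslate m i j) :
    IsLPP m k S (swapFun m i j) where
  invariant := hf.invariant
  equivariant γ hγ x _ := swapFun_smul hγ hij x
  orbits := hf.orbits
  inj x _ y _ r := by
    obtain ⟨γ, hγ, e⟩ := r
    refine ⟨γ, hγ, ?_⟩
    rw [← swapFun_smul hγ hij] at e
    have := congrArg (swapFun m i j) e
    rwa [swapFun_swapFun hij, swapFun_swapFun hij] at this

theorem comp_swapFun (hf : IsLPP m k S f) (hi : i ∈ S) (hj : j ∈ S)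
    (hij : NonTranslate m i j) : IsLPP m k S (f ∘ swapFun m i j) :=
  (hf.isLPP_swapFun hij).comp (by rwa [hf.swapFun_image hi hj hij])

theorem resolveFun_eq (hf : IsLPP m k S f) (hi : i ∈ S) (hj : j ∈ S) :
    resolveFun m f i j = f ∘ swapFun m i j := by
  ext x
  simp only [Function.comp, swapFun, resolveFun]
  split_ifs with h h'
  · exact (hf.equivariant _ h.choose_spec.1 j hj).symm
  · exact (hf.equivariant _ h'.choose_spec.1 i hi).symm
  · rfl

theorem nonTranslate_map (hf : IsLPP m k S f) (hi : i ∈ S) (hj : j ∈ S)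
    (hij : NonTranslate m i j) : NonTranslate m (f i) (f j) := by
  intro n e
  have hγ := Gm_translation_mem m n
  exact hij n (hf.injOn hj (hf.invariant _ hγ i hi) (e.trans (hf.equivariant _ hγ i hi).symm))

theorem nonTranslate_of_crosses (hf : IsLPP m k S f) (hi : i ∈ S) (h : Crosses f i j) :
    NonTranslate m i j := by
  intro n e
  have e' := hf.equivariant _ (Gm_translation_mem m n) i hi
  simp only [Equiv.coe_addRight] at e'
  rw [← e] at e'
  unfold Crosses at h
  omega

theorem comp_swapFun_eqOn (hf : IsLPP m k S f) (hi : i ∈ S) (hj : j ∈ S)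
    (hij : NonTranslate m i j) :
    Set.EqOn (swapFun m (f i) (f j) ∘ f) (f ∘ swapFun m i j) S := by
  intro x hx
  have hij' := hf.nonTranslate_map hi hj hij
  simp only [Function.comp]
  rcases swapFun_cases m i j x with ⟨g, hg, rfl⟩ | ⟨g, hg, rfl⟩ | ⟨h, h'⟩
  · rw [hf.equivariant g hg i hi, swapFun_left hg, swapFun_left hg, hf.equivariant g hg j hj]
  · rw [hf.equivariant g hg j hj, swapFun_right hg hij', swapFun_right hg hij,
      hf.equivariant g hg i hi]
  · rw [swapFun_of_notMem h h', swapFun_of_notMem]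
    · intro γ hγ e
      rw [← hf.equivariant γ hγ i hi] at e
      exact h γ hγ (hf.injOn (hf.invariant γ hγ i hi) hx e)
    · intro γ hγ e
      rw [← hf.equivariant γ hγ j hj] at e
      exact h' γ hγ (hf.injOn (hf.invariant γ hγ j hj) hx e)

/-- Swapping `i` and `j` moves a point only to a point with which it is crossed. -/
theorem crosses_swapFun_or_eq (hf : IsLPP m k S f) (hi : i ∈ S) (hj : j ∈ S) (h : Crosses f i j)
    (x : ℤ) : Crosses f x (swapFun m i j x) ∨ swapFun m i j x = x := by
  have hij := hf.nonTranslate_of_crosses hi h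
  rcases swapFun_cases m i j x with ⟨g, hg, rfl⟩ | ⟨g, hg, rfl⟩ | ⟨h1, h2⟩
  · rw [swapFun_left hg]
    exact Or.inl ((hf.crosses_smul_iff hg hi hj).2 h)
  · rw [swapFun_right hg hij]
    exact Or.inl ((hf.crosses_smul_iff hg hj hi).2 h.symm)
  · exact Or.inr (swapFun_of_notMem h1 h2)

theorem crossCount_comp_swapFun_lt (hf : IsLPP m k S f) (hm : 2 ≤ m) (hi : i ∈ S) (hj : j ∈ S)
    (h : Crosses f i j) : crossCount m S (f ∘ swapFun m i j) < crossCount m S f := by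
  have hij := hf.nonTranslate_of_crosses hi h
  have ht := hf.isLPP_swapFun hij
  have hf' := hf.comp_swapFun hi hj hij
  have hmemt : ∀ {x}, x ∈ S → swapFun m i j x ∈ S := fun hx => hf.swapFun_mem hi hj hij hx
  set t := swapFun m i j with ht_def
  have htt : ∀ x, t (t x) = x := swapFun_swapFun hij
  let φ : Set (Set ℤ) → Set (Set ℤ) := fun c =>
    if c ∈ crossings m S t then c else Set.image (Set.image t) c
  have hφ_pos : ∀ {a b}, a ∈ S → b ∈ S → Crosses t a b →
      φ (pairOrbit m (a, b)) = pairOrbit m (a, b) := fun ha hb hc =>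
    if_pos ((ht.pairOrbit_mem_crossings_iff ha hb).2 hc)
  have hφ_neg : ∀ {a b}, a ∈ S → b ∈ S → ¬ Crosses t a b →
      φ (pairOrbit m (a, b)) = pairOrbit m (t a, t b) := fun ha hb hc =>
    (if_neg (mt (ht.pairOrbit_mem_crossings_iff ha hb).1 hc)).trans (ht.pairOrbit_map ha hb).symm
  have ht_iff : ∀ a b, Crosses t (t a) (t b) ↔ Crosses t a b := by
    intro a b
    simp only [Crosses, htt]
    omega
  have key : ∀ c ∈ crossings m S (f ∘ t), φ c ∈ crossings m S f \ {pairOrbit m (i, j)} := by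
    intro c hc
    obtain ⟨a, ha, b, hb, hab, rfl⟩ := mem_crossings.1 hc
    have hta := hf.crosses_swapFun_or_eq hi hj h a
    have htb := hf.crosses_swapFun_or_eq hi hj h b
    rw [← ht_def] at hta htb
    have da := swapFun_sub_self hij a
    have db := swapFun_sub_self hij b
    rw [← ht_def] at da db
    by_cases hc' : Crosses t a b
    · rw [hφ_pos ha hb hc']
      refine ⟨(hf.pairOrbit_mem_crossings_iff ha hb).2 ?_, fun e => ?_⟩
      · unfold Crosses at *
        simp only [Function.comp] at hab
        have ea : t a = a → f (t a) = f a := congrArg f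
        have eb : t b = b → f (t b) = f b := congrArg f
        omega
      · rw [e, hf'.pairOrbit_mem_crossings_iff hi hj] at hc
        simp only [Crosses, Function.comp, ht_def, swapFun_self_left, swapFun_self_right hij]
          at hc h
        omega
    · rw [hφ_neg ha hb hc']
      refine ⟨(hf.pairOrbit_mem_crossings_iff (hmemt ha) (hmemt hb)).2 ?_, fun e => ?_⟩
      · have hne : t a = t b → a = b := fun e => by rw [← htt a, e, htt]
        unfold Crosses at *
        simp only [Function.comp] at hab
        omega
      · have := (ht.pairOrbit_mem_crossings_iff hi hj).2 (swapFun_crosses hij)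
        rw [← e, ht.pairOrbit_mem_crossings_iff (hmemt ha) (hmemt hb), ht_iff] at this
        exact hc' this
  have hinj : Set.InjOn φ (crossings m S (f ∘ t)) := by
    intro c hc d hd e
    obtain ⟨a, ha, b, hb, -, rfl⟩ := mem_crossings.1 hc
    obtain ⟨a', ha', b', hb', -, rfl⟩ := mem_crossings.1 hd
    by_cases h1 : Crosses t a b <;> by_cases h2 : Crosses t a' b'
    · rwa [hφ_pos ha hb h1, hφ_pos ha' hb' h2] at e
    · rw [hφ_pos ha hb h1, hφ_neg ha' hb' h2] at e
      have := (ht.pairOrbit_mem_crossings_iff ha hb).2 h1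
      rw [e, ht.pairOrbit_mem_crossings_iff (hmemt ha') (hmemt hb'), ht_iff] at this
      exact absurd this h2
    · rw [hφ_neg ha hb h1, hφ_pos ha' hb' h2] at e
      have := (ht.pairOrbit_mem_crossings_iff ha' hb').2 h2
      rw [← e, ht.pairOrbit_mem_crossings_iff (hmemt ha) (hmemt hb), ht_iff] at this
      exact absurd this h1
    · rw [hφ_neg ha hb h1, hφ_neg ha' hb' h2] at e
      exact ht.pairOrbit_map_inj ha hb ha' hb' e
  have hfin := hf.crossings_finite hm
  calc crossCount m S (f ∘ t)
      ≤ (crossings m S f \ {pairOrbit m (i, j)}).ncard :=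
        Set.ncard_le_ncard_of_injOn φ key hinj hfin.sdiff
    _ < crossCount m S f := Set.ncard_sdiff_singleton_lt_of_mem
        ((hf.pairOrbit_mem_crossings_iff hi hj).2 h) hfin

end IsLPP

/-! ### Weights -/

theorem weightSet_eq (l : ℤ) (S : Set ℤ) (f : ℤ → ℤ) :
    weightSet l S f = {i | i ∈ S ∧ ¬ (i < l ↔ f i < l)} := by
  ext i
  have h : ∀ a : ℤ, ((a : ℚ) < (l : ℚ) - 1 / 2 ↔ a < l) ∧ ((l : ℚ) - 1 / 2 < a ↔ l ≤ a) := by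
    intro a
    constructor <;> constructor <;> intro h
    · have : (a : ℚ) < l := by linarith
      exact_mod_cast this
    · have : (a : ℚ) + 1 ≤ l := by exact_mod_cast h
      linarith
    · have : (l : ℚ) < a + 1 := by linarith
      have : l < a + 1 := by exact_mod_cast this
      omega
    · have : (l : ℚ) ≤ a := by exact_mod_cast h
      linarith
  simp only [weightSet, Set.mem_ofPred_eq, (h i).1, (h i).2, (h (f i)).1, (h (f i)).2]
  refine and_congr_right fun _ => ?_
  omega

theorem weightSet_congr {l : ℤ} {S : Set ℤ} {f g : ℤ → ℤ} (e : Set.EqOn f g S) :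
    weightSet l S f = weightSet l S g := by
  simp only [weightSet_eq]
  ext i
  exact and_congr_right fun hi => by rw [e hi]

namespace IsLPP

variable {m k : ℕ} {S : Set ℤ} {f g : ℤ → ℤ} {i j : ℤ}

theorem weightSet_finite (hf : IsLPP m k S f) (hm : 2 ≤ m) (l : ℤ) :
    (weightSet l S f).Finite := by
  obtain ⟨B, hB⟩ := hf.exists_bound hm
  refine (Set.finite_Icc (l - B) (l + B)).subset ?_
  rw [weightSet_eq]
  rintro x ⟨hx, h⟩
  have := abs_le.1 (hB x hx)
  simp only [Set.mem_Icc]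
  omega

/-- `w_l(f) + w_l(g) - w_l(g ∘ f)` is a natural number. -/
theorem weight_comp (hf : IsLPP m k S f) (hg : IsLPP m k (f '' S) g) (hm : 2 ≤ m) (l : ℤ) :
    ∃ n : ℕ, (weightSet l S f).ncard + (weightSet l (f '' S) g).ncard =
      (weightSet l S (g ∘ f)).ncard + 2 * n := by
  set A := weightSet l S f with hA
  set B := {i | i ∈ S ∧ ¬ (f i < l ↔ g (f i) < l)} with hB
  set C := weightSet l S (g ∘ f) with hC
  have eB : weightSet l (f '' S) g = f '' B := by
    rw [weightSet_eq]
    ext x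
    constructor
    · rintro ⟨⟨y, hy, rfl⟩, h⟩
      exact ⟨y, ⟨hy, h⟩, rfl⟩
    · rintro ⟨y, ⟨hy, h⟩, rfl⟩
      exact ⟨⟨y, hy, rfl⟩, h⟩
  have hinj : Set.InjOn f B := hf.injOn.mono fun x hx => hx.1
  have fA : A.Finite := hf.weightSet_finite hm l
  have fB : B.Finite := Set.Finite.of_finite_image (eB ▸ hg.weightSet_finite hm l) hinj
  have eC : C = (A \ B) ∪ (B \ A) := by
    rw [hA, hB, hC, weightSet_eq, weightSet_eq]
    ext x
    simp only [Set.mem_ofPred_eq, Set.mem_union, Set.mem_sdiff, Function.comp]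
    tauto
  have hd : Disjoint (A \ B) (B \ A) :=
    Set.disjoint_left.2 fun x hx hx' => hx.2 hx'.1
  refine ⟨(A ∩ B).ncard, ?_⟩
  rw [eB, hinj.ncard_image, eC, Set.ncard_union_eq hd fA.sdiff fB.sdiff]
  have h1 := Set.ncard_inter_add_ncard_sdiff_eq_ncard A B fA
  have h2 := Set.ncard_inter_add_ncard_sdiff_eq_ncard B A fB
  rw [Set.inter_comm] at h2
  omega

theorem weight_swapFun (hf : IsLPP m k S f) (hm : 2 ≤ m) (hi : i ∈ S) (hj : j ∈ S)
    (hij : NonTranslate m i j) (l : ℤ) : ∃ n, (weightSet l S (swapFun m i j)).ncard = 2 * n := by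
  have ht := hf.isLPP_swapFun hij
  set t := swapFun m i j with ht_def
  have htt : ∀ x, t (t x) = x := swapFun_swapFun hij
  have hmemt : ∀ {x}, x ∈ S → t x ∈ S := fun hx => hf.swapFun_mem hi hj hij hx
  have hfin := ht.weightSet_finite hm l
  set V := {x | x ∈ S ∧ x < l ∧ l ≤ t x}
  have e : weightSet l S t = V ∪ t '' V := by
    rw [weightSet_eq]
    ext x
    constructor
    · rintro ⟨hx, h⟩
      by_cases hxl : x < l
      · exact Or.inl ⟨hx, hxl, by omega⟩
      · exact Or.inr ⟨t x, ⟨hmemt hx, by omega, by rw [htt]; omega⟩, htt x⟩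
    · rintro (⟨hx, h1, h2⟩ | ⟨y, ⟨hy, h1, h2⟩, rfl⟩)
      · exact ⟨hx, by omega⟩
      · exact ⟨hmemt hy, by rw [htt]; omega⟩
  have fV : V.Finite := hfin.subset (e ▸ Set.subset_union_left)
  have hd : Disjoint V (t '' V) := by
    refine Set.disjoint_left.2 ?_
    rintro _ ⟨_, h, _⟩ ⟨y, ⟨_, _, h'⟩, rfl⟩
    omega
  refine ⟨V.ncard, ?_⟩
  rw [e, Set.ncard_union_eq hd fV (fV.image t),
    (ht.injOn.mono fun x hx => hx.1).ncard_image]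
  omega

theorem weight_comp_swapFun_le (hf : IsLPP m k S f) (hm : 2 ≤ m) (hi : i ∈ S) (hj : j ∈ S)
    (h : Crosses f i j) (l : ℤ) :
    (weightSet l S (f ∘ swapFun m i j)).ncard ≤ (weightSet l S f).ncard := by
  have hij := hf.nonTranslate_of_crosses hi h
  have hmemt : ∀ {x}, x ∈ S → swapFun m i j x ∈ S := fun hx => hf.swapFun_mem hi hj hij hx
  have hcr := hf.crosses_swapFun_or_eq hi hj h
  set t := swapFun m i j with ht_def
  have htt : ∀ x, t (t x) = x := swapFun_swapFun hij
  have key : ∀ x ∈ weightSet l S (f ∘ t), x ∉ weightSet l S f →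
      t x ∈ weightSet l S f ∧ t x ∉ weightSet l S (f ∘ t) := by
    simp only [weightSet_eq, Set.mem_ofPred_eq, Function.comp, htt]
    rintro x ⟨hx, h1⟩ h2
    have := hcr x
    have ex : t x = x → f (t x) = f x := congrArg f
    have := hmemt hx
    simp only [hx, this, true_and] at h2 ⊢
    unfold Crosses at *
    omega
  refine Set.ncard_le_ncard_of_injOn (fun x => if x ∈ weightSet l S f then x else t x) ?_ ?_
    (hf.weightSet_finite hm l)
  · intro x hx
    split_ifs with h1
    · exact h1
    · exact (key x hx h1).1
  · intro x hx y hy e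
    dsimp only at e
    split_ifs at e with h1 h2 h2
    · exact e
    · exact absurd (e ▸ hx) (key y hy h2).2
    · exact absurd (e ▸ hy) (key x hx h1).2
    · rw [← htt x, e, htt]

/-- `w_l(f) - w_l(f_{⟨i,j⟩})` is a natural number. -/
theorem weight_comp_swapFun (hf : IsLPP m k S f) (hm : 2 ≤ m) (hi : i ∈ S) (hj : j ∈ S)
    (h : Crosses f i j) (l : ℤ) :
    ∃ n, (weightSet l S f).ncard = (weightSet l S (f ∘ swapFun m i j)).ncard + 2 * n := by
  have hij := hf.nonTranslate_of_crosses hi h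
  obtain ⟨a, ha⟩ := hf.weight_swapFun hm hi hj hij l
  have himg := hf.swapFun_image hi hj hij
  obtain ⟨b, hb⟩ := (hf.isLPP_swapFun hij).weight_comp (g := f) (by rwa [himg]) hm l
  rw [himg] at hb
  have := hf.weight_comp_swapFun_le hm hi hj h l
  exact ⟨((weightSet l S f).ncard - (weightSet l S (f ∘ swapFun m i j)).ncard) / 2, by omega⟩

end IsLPP

namespace IsLPP

variable {m k : ℕ} {S : Set ℤ} {f g : ℤ → ℤ} {i j : ℤ}

theorem nonTranslate_of_map (hf : IsLPP m k S f) (hi : i ∈ S)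
    (hij : NonTranslate m (f i) (f j)) : NonTranslate m i j := by
  intro n e
  have e' := hf.equivariant _ (Gm_translation_mem m n) i hi
  simp only [Equiv.coe_addRight, ← e] at e'
  exact hij n e'

theorem image_comp_swapFun (hf : IsLPP m k S f) (hi : i ∈ S) (hj : j ∈ S)
    (hij : NonTranslate m i j) : f ∘ swapFun m i j '' S = f '' S := by
  rw [Set.image_comp, hf.swapFun_image hi hj hij]

/-- Resolving a composite amounts to resolving the second factor. -/
theorem comp_swapFun_comp_eqOn (hf : IsLPP m k S f) (hi : i ∈ S) (hj : j ∈ S)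
    (hij : NonTranslate m i j) (g : ℤ → ℤ) :
    Set.EqOn ((g ∘ swapFun m (f i) (f j)) ∘ f) ((g ∘ f) ∘ swapFun m i j) S :=
  fun _ hx => congrArg g (hf.comp_swapFun_eqOn hi hj hij hx)

theorem mem_resCrossSet (hf : IsLPP m k S f) {f' : ℤ → ℤ} {c : Set (Set ℤ)} :
    c ∈ resCrossSet m S f f' ↔ ∃ i ∈ S, ∃ j ∈ S, Crosses f i j ∧
      Set.EqOn (f ∘ swapFun m i j) f' S ∧
      crossCount m S (f ∘ swapFun m i j) + 1 = crossCount m S f ∧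
      pairOrbit m (i, j) = c := by
  constructor
  · rintro ⟨⟨i, j⟩, ⟨⟨hi, hj, h⟩, h1, h2⟩, rfl⟩
    simp only at hi hj h h1 h2
    rw [hf.resolveFun_eq hi hj] at h1 h2
    exact ⟨i, hi, j, hj, Or.inl h, h1, h2, rfl⟩
  · rintro ⟨i, hi, j, hj, h, h1, h2, rfl⟩
    rcases h with h' | h'
    · refine ⟨(i, j), ⟨⟨hi, hj, h'⟩, ?_⟩, rfl⟩
      rw [hf.resolveFun_eq hi hj]
      exact ⟨h1, h2⟩
    · refine ⟨(j, i), ⟨⟨hj, hi, h'⟩, ?_⟩, pairOrbit_comm _ _ _⟩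
      rw [swapFun_comm (hf.nonTranslate_of_crosses hi (Or.inr h'))] at h1 h2
      rw [hf.resolveFun_eq hj hi]
      exact ⟨h1, h2⟩

theorem ncard_resCrossSet (hf : IsLPP m k S f) (hi : i ∈ S) (hj : j ∈ S)
    (hij : NonTranslate m i j) {f' : ℤ → ℤ} (e : Set.EqOn f' (f ∘ swapFun m i j) S) :
    (resCrossSet m S f f').ncard =
      if Crosses f i j ∧ crossCount m S (f ∘ swapFun m i j) + 1 = crossCount m S f
      then 1 else 0 := by
  have hsub : resCrossSet m S f f' ⊆ {pairOrbit m (i, j)} := by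
    intro c hc
    obtain ⟨a, ha, b, hb, h, h1, -, rfl⟩ := hf.mem_resCrossSet.1 hc
    have hab := hf.nonTranslate_of_crosses ha h
    have ht := hf.injOn (hf.swapFun_mem ha hb hab ha) (hf.swapFun_mem hi hj hij ha)
      ((h1 ha).trans (e ha))
    rw [swapFun_self_left] at ht
    exact (pairOrbit_eq_of_swapFun hij hab.ne ht.symm).symm
  split_ifs with h
  · have : pairOrbit m (i, j) ∈ resCrossSet m S f f' :=
      hf.mem_resCrossSet.2 ⟨i, hi, j, hj, h.1, e.symm, h.2, rfl⟩
    rw [hsub.antisymm (Set.singleton_subset_iff.2 this), Set.ncard_singleton]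
  · refine (congrArg Set.ncard (Set.eq_empty_of_forall_notMem fun c hc => h ?_)).trans
      (Set.ncard_empty _)
    have hc' := hsub hc
    rw [Set.mem_singleton_iff] at hc'
    obtain ⟨a, ha, b, hb, hab, h1, h2, rfl⟩ := hf.mem_resCrossSet.1 hc
    refine ⟨(hf.pairOrbit_mem_crossings_iff hi hj).1 ?_, ?_⟩
    · rw [← hc', hf.pairOrbit_mem_crossings_iff ha hb]
      exact hab
    · rwa [crossCount_congr (h1.trans e)] at h2

end IsLPP

/-! ### Basis elements and structure constants -/

namespace PongIdx

variable {m k : ℕ}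

/-- The basis element given by a lifted partial permutation. -/
def ofLPP {S : Set ℤ} {f : ℤ → ℤ} (hf : IsLPP m k S f) : PongIdx m k :=
  ⟨(S, fun x => if x ∈ S then f x else x), hf.congr fun _ hx => if_pos hx,
    fun _ hx => if_neg hx⟩

theorem ofLPP_fst {S : Set ℤ} {f : ℤ → ℤ} (hf : IsLPP m k S f) : (ofLPP hf).1.1 = S := rfl

theorem ofLPP_eqOn {S : Set ℤ} {f : ℤ → ℤ} (hf : IsLPP m k S f) :
    Set.EqOn (ofLPP hf).1.2 f S := fun _ hx => if_pos hx

theorem eq_of_eqOn {p q : PongIdx m k} (hS : p.1.1 = q.1.1) (e : Set.EqOn p.1.2 q.1.2 p.1.1) :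
    p = q := by
  refine Subtype.ext (Prod.ext hS (funext fun x => ?_))
  by_cases hx : x ∈ p.1.1
  · exact e hx
  · rw [p.2.2 x hx, q.2.2 x (hS ▸ hx)]

end PongIdx

section StructureConstants

variable {m k : ℕ} {S : Set ℤ} {f f' g : ℤ → ℤ} {i j : ℤ} {p q s t : PongIdx m k}

theorem expDiff_congr {f₁ f₁' : ℤ → ℤ} (e : Set.EqOn f f₁ S) (e' : Set.EqOn f' f₁' S) :
    expDiff m S f f' = expDiff m S f₁ f₁' := by
  simp only [expDiff, weightSet_congr e, weightSet_congr e']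

theorem expMul_congr {f₁ g₁ : ℤ → ℤ} (hf : Set.EqOn f f₁ S) (hg : Set.EqOn g g₁ (f₁ '' S)) :
    expMul m S (f₁ '' S) f g = expMul m S (f₁ '' S) f₁ g₁ := by
  have : Set.EqOn (g ∘ f) (g₁ ∘ f₁) S := fun x hx => by
    simp only [Function.comp, hf hx]
    exact hg ⟨x, hx, rfl⟩
  simp only [expMul, weightSet_congr hf, weightSet_congr hg, weightSet_congr this]

theorem Mdiff_eq (hpS : p.1.1 = S) (hp : Set.EqOn p.1.2 f S) (htS : t.1.1 = S)
    (hi : i ∈ S) (hj : j ∈ S) (hij : NonTranslate m i j)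
    (ht : Set.EqOn t.1.2 (f ∘ swapFun m i j) S) :
    Mdiff m k p t =
      if Crosses f i j ∧ crossCount m S (f ∘ swapFun m i j) + 1 = crossCount m S f
      then MvPolynomial.monomial (expDiff m S f (f ∘ swapFun m i j)) 1 else 0 := by
  subst hpS
  have hpf := p.2.1
  have e : Set.EqOn (f ∘ swapFun m i j) (p.1.2 ∘ swapFun m i j) p.1.1 :=
    fun x hx => (hp (hpf.swapFun_mem hi hj hij hx)).symm
  have hc : Crosses p.1.2 i j ↔ Crosses f i j := by rw [Crosses, Crosses, hp hi, hp hj]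
  rw [Mdiff, if_pos htS, hpf.ncard_resCrossSet hi hj hij (ht.trans e), expDiff_congr hp ht,
    ← crossCount_congr e, crossCount_congr hp, hc]
  split_ifs <;> simp

theorem Mmul_eq (hpS : p.1.1 = S) (hp : Set.EqOn p.1.2 f S) (hqS : q.1.1 = f '' S)
    (hq : Set.EqOn q.1.2 g (f '' S)) (hsS : s.1.1 = S) (hs : Set.EqOn s.1.2 (g ∘ f) S) :
    Mmul m k p q s =
      if crossCount m S (g ∘ f) = crossCount m S f + crossCount m (f '' S) g
      then MvPolynomial.monomial (expMul m S (f '' S) f g) 1 else 0 := by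
  subst hpS
  have e : Set.EqOn (q.1.2 ∘ p.1.2) (g ∘ f) p.1.1 := fun x hx => by
    simp only [Function.comp, hp hx]
    exact hq ⟨x, hx, rfl⟩
  rw [Mmul, hqS, expMul_congr hp hq, crossCount_congr e, crossCount_congr hp,
    crossCount_congr hq]
  have h1 : f '' p.1.1 = p.1.2 '' p.1.1 := (Set.image_congr hp).symm
  refine if_congr ⟨fun h => h.2.1, fun h => ⟨h1, h, hsS, hs.trans e.symm⟩⟩ rfl rfl

theorem exists_of_Mdiff_ne_zero (h : Mdiff m k p t ≠ 0) :
    t.1.1 = p.1.1 ∧ ∃ i ∈ p.1.1, ∃ j ∈ p.1.1, NonTranslate m i j ∧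
      Set.EqOn t.1.2 (p.1.2 ∘ swapFun m i j) p.1.1 := by
  rw [Mdiff] at h
  split_ifs at h with hS
  · refine ⟨hS, ?_⟩
    by_contra hne
    have hempty : resCrossSet m p.1.1 p.1.2 t.1.2 = ∅ := by
      refine Set.eq_empty_of_forall_notMem fun c hc => hne ?_
      obtain ⟨i, hi, j, hj, hc, e, -⟩ := p.2.1.mem_resCrossSet.1 hc
      exact ⟨i, hi, j, hj, p.2.1.nonTranslate_of_crosses hi hc, e.symm⟩
    simp [hempty] at h
  · exact absurd rfl h

theorem eqOn_of_Mmul_ne_zero (h : Mmul m k p q s ≠ 0) :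
    q.1.1 = p.1.2 '' p.1.1 ∧ s.1.1 = p.1.1 ∧ Set.EqOn s.1.2 (q.1.2 ∘ p.1.2) p.1.1 := by
  rw [Mmul] at h
  split_ifs at h with h'
  · exact ⟨h'.1, h'.2.2⟩
  · exact absurd rfl h

/-- `s` is obtained from the composite of `p` and `q` by swapping `i` and `j`. -/
structure IsSwapOfComp (p q s : PongIdx m k) (i j : ℤ) : Prop where
  image : q.1.1 = p.1.2 '' p.1.1
  domain : s.1.1 = p.1.1
  left_mem : i ∈ p.1.1
  right_mem : j ∈ p.1.1
  nonTranslate : NonTranslate m i j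
  eqOn : Set.EqOn s.1.2 ((q.1.2 ∘ p.1.2) ∘ swapFun m i j) p.1.1

theorem exists_isSwapOfComp_of_mul_diff (h : Mmul m k p q t * Mdiff m k t s ≠ 0) :
    ∃ i j, IsSwapOfComp p q s i j := by
  obtain ⟨hq, htS, ht⟩ := eqOn_of_Mmul_ne_zero (left_ne_zero_of_mul h)
  obtain ⟨hsS, i, hi, j, hj, hij, hs⟩ := exists_of_Mdiff_ne_zero (right_ne_zero_of_mul h)
  rw [htS] at hi hj hs hsS
  exact ⟨i, j, hq, hsS, hi, hj, hij,
    fun x hx => (hs hx).trans (ht (p.2.1.swapFun_mem hi hj hij hx))⟩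

theorem exists_isSwapOfComp_of_diff_mul_left (h : Mdiff m k p t * Mmul m k t q s ≠ 0) :
    ∃ i j, IsSwapOfComp p q s i j := by
  obtain ⟨htS, i, hi, j, hj, hij, ht⟩ := exists_of_Mdiff_ne_zero (left_ne_zero_of_mul h)
  obtain ⟨hq, hsS, hs⟩ := eqOn_of_Mmul_ne_zero (right_ne_zero_of_mul h)
  rw [htS] at hq hs hsS
  rw [Set.image_congr ht, p.2.1.image_comp_swapFun hi hj hij] at hq
  exact ⟨i, j, hq, hsS, hi, hj, hij, fun x hx => (hs hx).trans (congrArg q.1.2 (ht hx))⟩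

theorem exists_isSwapOfComp_of_diff_mul_right (h : Mdiff m k q t * Mmul m k p t s ≠ 0) :
    ∃ i j, IsSwapOfComp p q s i j := by
  obtain ⟨htS, i, hi, j, hj, hij, ht⟩ := exists_of_Mdiff_ne_zero (left_ne_zero_of_mul h)
  obtain ⟨hq, hsS, hs⟩ := eqOn_of_Mmul_ne_zero (right_ne_zero_of_mul h)
  rw [htS] at hq
  rw [hq] at hi hj ht
  obtain ⟨i, hi, rfl⟩ := hi
  obtain ⟨j, hj, rfl⟩ := hj
  have hij' := p.2.1.nonTranslate_of_map hi hij
  refine ⟨i, j, hq, hsS, hi, hj, hij', fun x hx => ?_⟩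
  rw [← p.2.1.comp_swapFun_comp_eqOn hi hj hij' q.1.2 hx]
  exact (hs hx).trans (ht ⟨x, hx, rfl⟩)

/-- The exponent common to all terms of the Leibniz rule. -/
def expLeibniz (m : ℕ) (S T : Set ℤ) (f g h : ℤ → ℤ) : Fin m →₀ ℕ :=
  Finsupp.equivFunOnFinite.symm fun l =>
    ((weightSet (((l : ℕ) : ℤ) + 1) S f).ncard
      + (weightSet (((l : ℕ) : ℤ) + 1) T g).ncard
      - (weightSet (((l : ℕ) : ℤ) + 1) S h).ncard) / 2

namespace IsSwapOfComp

theorem isLPP_right (h : IsSwapOfComp p q s i j) : IsLPP m k (p.1.2 '' p.1.1) q.1.2 :=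
  h.image ▸ q.2.1

theorem finsum_mul_diff (h : IsSwapOfComp p q s i j) (hm : 2 ≤ m) :
    ∑ᶠ t : PongIdx m k, Mmul m k p q t * Mdiff m k t s =
      if crossCount m p.1.1 (q.1.2 ∘ p.1.2) =
          crossCount m p.1.1 p.1.2 + crossCount m (p.1.2 '' p.1.1) q.1.2 ∧
        Crosses (q.1.2 ∘ p.1.2) i j ∧
        crossCount m p.1.1 ((q.1.2 ∘ p.1.2) ∘ swapFun m i j) + 1 =
          crossCount m p.1.1 (q.1.2 ∘ p.1.2)
      then MvPolynomial.monomial (expLeibniz m p.1.1 (p.1.2 '' p.1.1) p.1.2 q.1.2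
        ((q.1.2 ∘ p.1.2) ∘ swapFun m i j)) 1
      else 0 := by
  have hc := p.2.1.comp h.isLPP_right
  rw [finsum_eq_single _ (PongIdx.ofLPP hc)]
  · rw [Mmul_eq rfl (fun _ _ => rfl) h.image (fun _ _ => rfl)
        (PongIdx.ofLPP_fst hc) (PongIdx.ofLPP_eqOn hc),
      Mdiff_eq (PongIdx.ofLPP_fst hc) (PongIdx.ofLPP_eqOn hc) h.domain
        h.left_mem h.right_mem h.nonTranslate h.eqOn,
      ite_zero_mul_ite_zero, MvPolynomial.monomial_mul, one_mul]
    refine if_ctx_congr Iff.rfl (fun hcr => ?_) fun _ => rfl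
    refine congrArg (fun e => MvPolynomial.monomial e (1 : ZMod 2)) (Finsupp.ext fun l => ?_)
    obtain ⟨a, ha⟩ := p.2.1.weight_comp h.isLPP_right hm (((l : ℕ) : ℤ) + 1)
    obtain ⟨b, hb⟩ := hc.weight_comp_swapFun hm h.left_mem h.right_mem hcr.2.1
      (((l : ℕ) : ℤ) + 1)
    simp only [expMul, expDiff, expLeibniz, Finsupp.add_apply,
      Finsupp.coe_equivFunOnFinite_symm]
    omega
  · intro t ht
    by_contra hne
    obtain ⟨-, htS, hte⟩ := eqOn_of_Mmul_ne_zero (left_ne_zero_of_mul hne)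
    refine ht (PongIdx.eq_of_eqOn htS ?_)
    rw [htS]
    exact hte.trans (PongIdx.ofLPP_eqOn hc).symm

theorem finsum_diff_mul_left (h : IsSwapOfComp p q s i j) (hm : 2 ≤ m) :
    ∑ᶠ t : PongIdx m k, Mdiff m k p t * Mmul m k t q s =
      if (Crosses p.1.2 i j ∧
          crossCount m p.1.1 (p.1.2 ∘ swapFun m i j) + 1 = crossCount m p.1.1 p.1.2) ∧
        crossCount m p.1.1 ((q.1.2 ∘ p.1.2) ∘ swapFun m i j) =
          crossCount m p.1.1 (p.1.2 ∘ swapFun m i j) + crossCount m (p.1.2 '' p.1.1) q.1.2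
      then MvPolynomial.monomial (expLeibniz m p.1.1 (p.1.2 '' p.1.1) p.1.2 q.1.2
        ((q.1.2 ∘ p.1.2) ∘ swapFun m i j)) 1
      else 0 := by
  have hc := p.2.1.comp_swapFun h.left_mem h.right_mem h.nonTranslate
  have himg := p.2.1.image_comp_swapFun h.left_mem h.right_mem h.nonTranslate
  rw [finsum_eq_single _ (PongIdx.ofLPP hc)]
  · rw [Mdiff_eq rfl (fun _ _ => rfl) (PongIdx.ofLPP_fst hc) h.left_mem h.right_mem h.nonTranslate
        (PongIdx.ofLPP_eqOn hc),
      Mmul_eq (PongIdx.ofLPP_fst hc) (PongIdx.ofLPP_eqOn hc)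
        (himg ▸ h.image) (fun _ _ => rfl) h.domain h.eqOn,
      ite_zero_mul_ite_zero, MvPolynomial.monomial_mul, one_mul, himg]
    refine if_ctx_congr Iff.rfl (fun hcr => ?_) fun _ => rfl
    refine congrArg (fun e => MvPolynomial.monomial e (1 : ZMod 2)) (Finsupp.ext fun l => ?_)
    obtain ⟨a, ha⟩ := hc.weight_comp (himg.symm ▸ h.isLPP_right) hm (((l : ℕ) : ℤ) + 1)
    obtain ⟨b, hb⟩ := p.2.1.weight_comp_swapFun hm h.left_mem h.right_mem hcr.1.1
      (((l : ℕ) : ℤ) + 1)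
    rw [himg] at ha
    simp only [expMul, expDiff, expLeibniz, Finsupp.add_apply,
      Finsupp.coe_equivFunOnFinite_symm, Function.comp_assoc] at *
    omega
  · intro t ht
    by_contra hne
    obtain ⟨htS, -⟩ := exists_of_Mdiff_ne_zero (left_ne_zero_of_mul hne)
    obtain ⟨hq, -, hs⟩ := eqOn_of_Mmul_ne_zero (right_ne_zero_of_mul hne)
    refine ht (PongIdx.eq_of_eqOn htS ?_)
    rw [htS] at hq hs ⊢
    refine Set.EqOn.trans (fun x hx => ?_) (PongIdx.ofLPP_eqOn hc).symm
    refine q.2.1.injOn (hq ▸ ⟨x, hx, rfl⟩) ?_ ((hs hx).symm.trans (h.eqOn hx))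
    exact h.image ▸ ⟨_, p.2.1.swapFun_mem h.left_mem h.right_mem h.nonTranslate hx, rfl⟩

theorem finsum_diff_mul_right (h : IsSwapOfComp p q s i j) (hm : 2 ≤ m) :
    ∑ᶠ t : PongIdx m k, Mdiff m k q t * Mmul m k p t s =
      if (Crosses q.1.2 (p.1.2 i) (p.1.2 j) ∧
          crossCount m (p.1.2 '' p.1.1) (q.1.2 ∘ swapFun m (p.1.2 i) (p.1.2 j)) + 1 =
            crossCount m (p.1.2 '' p.1.1) q.1.2) ∧
        crossCount m p.1.1 ((q.1.2 ∘ p.1.2) ∘ swapFun m i j) = crossCount m p.1.1 p.1.2 +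
          crossCount m (p.1.2 '' p.1.1) (q.1.2 ∘ swapFun m (p.1.2 i) (p.1.2 j))
      then MvPolynomial.monomial (expLeibniz m p.1.1 (p.1.2 '' p.1.1) p.1.2 q.1.2
        ((q.1.2 ∘ p.1.2) ∘ swapFun m i j)) 1
      else 0 := by
  have hi : p.1.2 i ∈ p.1.2 '' p.1.1 := ⟨i, h.left_mem, rfl⟩
  have hj : p.1.2 j ∈ p.1.2 '' p.1.1 := ⟨j, h.right_mem, rfl⟩
  have hij := p.2.1.nonTranslate_map h.left_mem h.right_mem h.nonTranslate
  have hc := h.isLPP_right.comp_swapFun hi hj hij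
  have e := p.2.1.comp_swapFun_comp_eqOn h.left_mem h.right_mem h.nonTranslate q.1.2
  rw [finsum_eq_single _ (PongIdx.ofLPP hc)]
  · rw [Mdiff_eq h.image (fun _ _ => rfl) (PongIdx.ofLPP_fst hc) hi hj
        hij (PongIdx.ofLPP_eqOn hc),
      Mmul_eq rfl (fun _ _ => rfl)
        (PongIdx.ofLPP_fst hc) (PongIdx.ofLPP_eqOn hc) h.domain (h.eqOn.trans e.symm),
      ite_zero_mul_ite_zero, MvPolynomial.monomial_mul, one_mul, crossCount_congr e]
    refine if_ctx_congr Iff.rfl (fun hcr => ?_) fun _ => rfl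
    refine congrArg (fun e => MvPolynomial.monomial e (1 : ZMod 2)) (Finsupp.ext fun l => ?_)
    obtain ⟨a, ha⟩ := p.2.1.weight_comp hc hm (((l : ℕ) : ℤ) + 1)
    obtain ⟨b, hb⟩ := h.isLPP_right.weight_comp_swapFun hm hi hj hcr.1.1 (((l : ℕ) : ℤ) + 1)
    rw [weightSet_congr e] at ha
    simp only [expMul, expDiff, expLeibniz, Finsupp.add_apply,
      Finsupp.coe_equivFunOnFinite_symm, weightSet_congr e]
    omega
  · intro t ht
    by_contra hne
    obtain ⟨htS, -⟩ := exists_of_Mdiff_ne_zero (left_ne_zero_of_mul hne)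
    obtain ⟨-, -, hs⟩ := eqOn_of_Mmul_ne_zero (right_ne_zero_of_mul hne)
    rw [h.image] at htS
    refine ht (PongIdx.eq_of_eqOn htS ?_)
    rw [htS]
    refine Set.EqOn.trans ?_ (PongIdx.ofLPP_eqOn hc).symm
    rintro _ ⟨x, hx, rfl⟩
    exact (hs hx).symm.trans ((h.eqOn hx).trans (e hx).symm)

end IsSwapOfComp

end StructureConstants

/-- The differential of the pong algebra satisfies the
Leibniz rule: `∂(μ₂(a, b)) = μ₂(∂a, b) + μ₂(a, ∂b)` (coefficients in `F₂`).
Since `P(m, k)` is the free `F₂[v₁, …, v_m]`-module on the set of lifted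
partial permutations, with `∂` linear with structure constants `Mdiff` and
`μ₂` bilinear with structure constants `Mmul`, this says exactly that the
matrix coefficients of the two sides agree. -/
theorem pong_leibniz (m k : ℕ) (hm : 2 ≤ m) (hk0 : 0 < k) (hkm : k < m) :
    ∀ p q s : PongIdx m k,
      ∑ᶠ t : PongIdx m k, Mmul m k p q t * Mdiff m k t s =
        (∑ᶠ t : PongIdx m k, Mdiff m k p t * Mmul m k t q s) +
          (∑ᶠ t : PongIdx m k, Mdiff m k q t * Mmul m k p t s) := by
  intro p q s
  by_cases hex : ∃ i j, IsSwapOfComp p q s i j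
  · obtain ⟨i, j, h⟩ := hex
    rw [h.finsum_mul_diff hm, h.finsum_diff_mul_left hm, h.finsum_diff_mul_right hm]
    have hf := p.2.1
    have hg := h.isLPP_right
    have hgf := hf.comp hg
    have hi := h.left_mem
    have hj := h.right_mem
    have hij := h.nonTranslate
    have hfi : p.1.2 i ∈ p.1.2 '' p.1.1 := ⟨i, hi, rfl⟩
    have hfj : p.1.2 j ∈ p.1.2 '' p.1.1 := ⟨j, hj, rfl⟩
    have himg := hf.image_comp_swapFun hi hj hij
    have hcross : Crosses (q.1.2 ∘ p.1.2) i j ↔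
        ¬ (Crosses p.1.2 i j ↔ Crosses q.1.2 (p.1.2 i) (p.1.2 j)) := by
      have h1 := hij.ne
      have h2 := (hf.nonTranslate_map hi hj hij).ne
      have h3 := (hgf.nonTranslate_map hi hj hij).ne
      simp only [Crosses, Function.comp] at h3 ⊢
      omega
    have hle := hf.crossCount_comp_le hg hm
    have hlt := hf.crossCount_comp_lt hg hm hi hj
    have hf_lt := hf.crossCount_comp_swapFun_lt hm hi hj
    have hg_lt := hg.crossCount_comp_swapFun_lt hm hfi hfj
    have hgf_lt := hgf.crossCount_comp_swapFun_lt hm hi hj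
    have hle_left := (hf.comp_swapFun hi hj hij).crossCount_comp_le (himg.symm ▸ hg) hm
    rw [himg, ← Function.comp_assoc] at hle_left
    have hle_right := hf.crossCount_comp_le
      (hg.comp_swapFun hfi hfj (hf.nonTranslate_map hi hj hij)) hm
    rw [crossCount_congr (hf.comp_swapFun_comp_eqOn hi hj hij q.1.2)] at hle_right
    split_ifs <;> first
      | exact (CharTwo.add_self_eq_zero _).symm
      | (simp only [add_zero, zero_add]; done)
      | (exfalso; grind)
  · rw [finsum_eq_zero_of_forall_eq_zero fun t => by_contra fun hne =>
        hex (exists_isSwapOfComp_of_mul_diff hne),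
      finsum_eq_zero_of_forall_eq_zero fun t => by_contra fun hne =>
        hex (exists_isSwapOfComp_of_diff_mul_left hne),
      finsum_eq_zero_of_forall_eq_zero fun t => by_contra fun hne =>
        hex (exists_isSwapOfComp_of_diff_mul_right hne), add_zero]
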